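/- Let R be a commutative Noetherian semiperfect ring and C a semidualizing R-module. Let M be a finitely generated R-module in the Bass class B_C which is horizontally linked with respect to C. Then G_C-dim_R(M) = 0 if and only if G-dim_R(Hom_R(C, λ_R(C,M))) = 0. -/

import Mathlib

/- Preliminary definitions for formalizing
   "Linkage of modules with respect to a semidualizing module"
   (Dibaei–Sadeghi). -/

open CategoryTheory

universe u
noncomputable section
namespace Paper

variable (R : Type u) [CommRing R]

/-- `Ext^i_R(M,N)`, realized via Mathlib's derived-functor `Ext` for the
`R`-linear abelian category of `R`-modules. -/
abbrev ExtGrp (M N : Type u) [AddCommGroup M] [Module R M] [AddCommGroup N] [Module R N]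
    (i : ℕ) : Type u :=
  ((Ext R (ModuleCat.{u} R) i).obj (Opposite.op (ModuleCat.of R M))).obj (ModuleCat.of R N)

/-- `Tor^R_i(M,N)`. -/
abbrev TorGrp (M N : Type u) [AddCommGroup M] [Module R M] [AddCommGroup N] [Module R N]
    (i : ℕ) : Type u :=
  ((Tor (ModuleCat.{u} R) i).obj (ModuleCat.of R M)).obj (ModuleCat.of R N)

/-- Local cohomology `H^i_I(M)`. -/
abbrev LocCoh (I : Ideal R) (i : ℕ) (M : Type u) [AddCommGroup M] [Module R M] : Type u :=
  (localCohomology I i).obj (ModuleCat.of R M)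

/-- A commutative ring is semiperfect iff it is a finite direct product of
commutative local rings. -/
def IsSemiperfectRing : Prop :=
  ∃ (n : ℕ) (A : Fin n → Type u) (c : ∀ i, CommRing (A i)),
    (∀ i, letI := c i; IsLocalRing (A i)) ∧
    (letI := c; Nonempty (R ≃+* ((i : Fin n) → A i)))

/-- `C` is a semidualizing `R`-module: `C` is finitely generated, the homothety map
`R → Hom_R(C,C)` is bijective, and `Ext^i_R(C,C) = 0` for all `i > 0`. -/
def IsSemidualizing (C : Type u) [AddCommGroup C] [Module R C] : Prop :=
  Module.Finite R C ∧
  Function.Bijective (LinearMap.lsmul R C) ∧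
  ∀ i : ℕ, 0 < i → Subsingleton (ExtGrp R C C i)

/-- A minimal projective presentation `P₁ → P₀ → M → 0` of `M`:
both `P₀ → M` and the induced `P₁ → ker(P₀ → M)` are projective covers
(surjections from finitely generated projectives with superfluous kernels). -/
structure MinPres (M : Type u) [AddCommGroup M] [Module R M] where
  P₁ : Type u
  P₀ : Type u
  [acg₁ : AddCommGroup P₁]
  [acg₀ : AddCommGroup P₀]
  [mod₁ : Module R P₁]
  [mod₀ : Module R P₀]
  f : P₁ →ₗ[R] P₀
  g : P₀ →ₗ[R] M
  finite₁ : Module.Finite R P₁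
  finite₀ : Module.Finite R P₀
  proj₁ : Module.Projective R P₁
  proj₀ : Module.Projective R P₀
  surj : Function.Surjective g
  exact : LinearMap.range f = LinearMap.ker g
  min₀ : ∀ N : Submodule R P₀, N ⊔ LinearMap.ker g = ⊤ → N = ⊤
  min₁ : ∀ N : Submodule R P₁, N ⊔ LinearMap.ker f = ⊤ → N = ⊤

attribute [instance] MinPres.acg₁ MinPres.acg₀ MinPres.mod₁ MinPres.mod₀

variable {R}

/-- Given a minimal presentation `P₁ --f--> P₀ → X → 0` this is
`Hom(f,C) : Hom_R(P₀,C) → Hom_R(P₁,C)`; its image is `Ω_C Tr_C X` and its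
cokernel is the transpose `Tr_C X` of `X` with respect to `C`. -/
def MinPres.homC {X : Type u} [AddCommGroup X] [Module R X]
    (C : Type u) [AddCommGroup C] [Module R C] (pres : MinPres R X) :
    (pres.P₀ →ₗ[R] C) →ₗ[R] (pres.P₁ →ₗ[R] C) :=
  LinearMap.lcomp R C pres.f

/-- `Tr_C X` computed from a given minimal presentation. -/
def MinPres.trC {X : Type u} [AddCommGroup X] [Module R X]
    (C : Type u) [AddCommGroup C] [Module R C] (pres : MinPres R X) : Type u :=
  (pres.P₁ →ₗ[R] C) ⧸ LinearMap.range (pres.homC C)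

instance {X : Type u} [AddCommGroup X] [Module R X] (C : Type u) [AddCommGroup C] [Module R C]
    (pres : MinPres R X) : AddCommGroup (pres.trC C) :=
  inferInstanceAs (AddCommGroup ((pres.P₁ →ₗ[R] C) ⧸ LinearMap.range (pres.homC C)))

instance {X : Type u} [AddCommGroup X] [Module R X] (C : Type u) [AddCommGroup C] [Module R C]
    (pres : MinPres R X) : Module R (pres.trC C) :=
  inferInstanceAs (Module R ((pres.P₁ →ₗ[R] C) ⧸ LinearMap.range (pres.homC C)))

variable (R)

/-- `N ≅ Ω_C Tr_C X` : `N` is (isomorphic to) the image of `Hom(f,C)` for a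
minimal projective presentation `P₁ --f--> P₀ → X → 0` of `X`. -/
def IsOmegaTrC (C : Type u) [AddCommGroup C] [Module R C]
    (X : Type u) [AddCommGroup X] [Module R X]
    (N : Type u) [AddCommGroup N] [Module R N] : Prop :=
  ∃ pres : MinPres R X, Nonempty (N ≃ₗ[R] ↥(LinearMap.range (pres.homC C)))

/-- `N ≅ λ_R(C,M) = Ω_C Tr_C (Hom_R(C,M))`. -/
def IsLambdaOf (C : Type u) [AddCommGroup C] [Module R C]
    (M : Type u) [AddCommGroup M] [Module R M]
    (N : Type u) [AddCommGroup N] [Module R N] : Prop :=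
  IsOmegaTrC R C (C →ₗ[R] M) N

/-- `M` is horizontally linked with respect to `C` : `M ≅ λ_R(C, λ_R(C,M))`. -/
def IsHorizontallyLinked (C : Type u) [AddCommGroup C] [Module R C]
    (M : Type u) [AddCommGroup M] [Module R M] : Prop :=
  ∃ N : ModuleCat.{u} R, IsLambdaOf R C M N ∧ IsLambdaOf R C N M

/-- `M` is horizontally linked in the sense of Martsinkovsky–Strooker:
`M ≅ λ(λ M)` where `λ = Ω Tr`. -/
def IsHorizontallyLinkedMS (M : Type u) [AddCommGroup M] [Module R M] : Prop :=
  ∃ N : ModuleCat.{u} R, IsOmegaTrC R R M N ∧ IsOmegaTrC R R N M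

/-- `underline-Hom_R(M,N) = 0` : every homomorphism `M → N` factors through a
projective module. -/
def StableHomZero (M N : Type u) [AddCommGroup M] [Module R M]
    [AddCommGroup N] [Module R N] : Prop :=
  ∀ φ : M →ₗ[R] N, ∃ P : ModuleCat.{u} R, Module.Projective R P ∧
    ∃ (α : M →ₗ[R] P) (β : (P : Type u) →ₗ[R] N), β ∘ₗ α = φ

/-- `M` is `C`-stable: `M` has no nonzero direct summand of the form `P ⊗_R C`
with `P` projective. -/
def IsCStable (C M : Type u) [AddCommGroup C] [Module R C]
    [AddCommGroup M] [Module R M] : Prop :=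
  ∀ N₁ N₂ : Submodule R M, IsCompl N₁ N₂ →
    ∀ P : ModuleCat.{u} R, Module.Projective R P →
      Nonempty (↥N₁ ≃ₗ[R] TensorProduct R P C) → N₁ = ⊥

/-- `M` is a `C`-syzygy: `M` embeds into a module `P ⊗_R C` with `P` projective. -/
def IsCSyzygy (C M : Type u) [AddCommGroup C] [Module R C]
    [AddCommGroup M] [Module R M] : Prop :=
  ∃ P : ModuleCat.{u} R, Module.Projective R P ∧
    ∃ ι : M →ₗ[R] TensorProduct R (P : Type u) C, Function.Injective ι

/-- Auxiliary recursion for `n`-th `C`-syzygies. -/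
def IsNthCSyzygyAux (C : Type u) [AddCommGroup C] [Module R C] :
    ℕ → ModuleCat.{u} R → Prop
  | 0, _ => True
  | (m+1), M =>
    ∃ P : ModuleCat.{u} R, Module.Projective R P ∧
      ∃ ι : (M : Type u) →ₗ[R] TensorProduct R (P : Type u) C, Function.Injective ι ∧
        IsNthCSyzygyAux C m
          (ModuleCat.of R (TensorProduct R (P : Type u) C ⧸ LinearMap.range ι))

/-- `M` is an `n`-th `C`-syzygy: there is an exact sequence
`0 → M → C₁ → ⋯ → C_n` with each `C_j` of the form `P_j ⊗_R C`, `P_j` projective. -/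
def IsNthCSyzygy (n : ℕ) (C M : Type u) [AddCommGroup C] [Module R C]
    [AddCommGroup M] [Module R M] : Prop :=
  IsNthCSyzygyAux R C n (ModuleCat.of R M)

/-- The biduality map `M → Hom_R(Hom_R(M,C),C)`. -/
def bidualityMap (C M : Type u) [AddCommGroup C] [Module R C]
    [AddCommGroup M] [Module R M] : M →ₗ[R] ((M →ₗ[R] C) →ₗ[R] C) :=
  (LinearMap.id : (M →ₗ[R] C) →ₗ[R] (M →ₗ[R] C)).flip

/-- `M` has `G_C`-dimension zero. -/
def GCdimZero (C M : Type u) [AddCommGroup C] [Module R C]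
    [AddCommGroup M] [Module R M] : Prop :=
  Module.Finite R M ∧
  Function.Bijective (bidualityMap R C M) ∧
  (∀ i : ℕ, 0 < i → Subsingleton (ExtGrp R M C i)) ∧
  (∀ i : ℕ, 0 < i → Subsingleton (ExtGrp R (M →ₗ[R] C) C i))

/-- `G_C`-dim`_R(M) ≤ n`: there is a resolution of `M` of length `≤ n` by modules of
`G_C`-dimension zero. -/
def GCdimLE (C M : Type u) [AddCommGroup C] [Module R C]
    [AddCommGroup M] [Module R M] (n : ℕ) : Prop :=
  ∃ (G : ℕ → ModuleCat.{u} R) (d : ∀ i : ℕ, (G (i+1) : Type u) →ₗ[R] G i)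
    (ε : (G 0 : Type u) →ₗ[R] M),
    Function.Surjective ε ∧
    LinearMap.range (d 0) = LinearMap.ker ε ∧
    (∀ i : ℕ, LinearMap.range (d (i+1)) = LinearMap.ker (d i)) ∧
    (∀ i : ℕ, GCdimZero R C (G i)) ∧
    (∀ i : ℕ, n < i → Subsingleton (G i))

/-- `G_C`-dim`_R(M) < ∞`. -/
def GCdimFinite (C M : Type u) [AddCommGroup C] [Module R C]
    [AddCommGroup M] [Module R M] : Prop :=
  ∃ n : ℕ, GCdimLE R C M n

/-- The "depth of `I` on `M`" (classical grade): `inf{ i | Ext^i_R(R/I, M) ≠ 0 }`,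
as an extended natural number. -/
def edepth (I : Ideal R) (M : Type u) [AddCommGroup M] [Module R M] : ℕ∞ :=
  sInf {n : ℕ∞ | ∃ i : ℕ, n = i ∧ Nontrivial (ExtGrp R (R ⧸ I) M i)}

/-- The depth of a module over a local ring. -/
def ldepth [IsLocalRing R] (M : Type u) [AddCommGroup M] [Module R M] : ℕ∞ :=
  edepth R (IsLocalRing.maximalIdeal R) M

/-- `depth_{R_p}(M_p)`. -/
def depthAt (p : Ideal R) [p.IsPrime] (M : Type u) [AddCommGroup M] [Module R M] : ℕ∞ :=
  ldepth (Localization.AtPrime p) (LocalizedModule p.primeCompl M)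

/-- `depth R_p`. -/
def ringDepthAt (p : Ideal R) [p.IsPrime] : ℕ∞ :=
  ldepth (Localization.AtPrime p) (Localization.AtPrime p)

/-- Serre's condition `(S̃_n)`:
`depth_{R_p}(M_p) ≥ min{n, depth R_p}` for all primes `p`. -/
def SerreTilde (n : ℕ) (M : Type u) [AddCommGroup M] [Module R M] : Prop :=
  ∀ (p : Ideal R) (_ : p.IsPrime), min (n : ℕ∞) (ringDepthAt R p) ≤ depthAt R p M

/-- Serre's condition `(S_n)`:
`depth_{R_p}(M_p) ≥ min{n, dim R_p}` for all primes `p`. -/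
def SerreS (n : ℕ) (M : Type u) [AddCommGroup M] [Module R M] : Prop :=
  ∀ (p : Ideal R) (_ : p.IsPrime),
    min (n : WithBot ℕ∞) (ringKrullDim (Localization.AtPrime p)) ≤ (depthAt R p M : WithBot ℕ∞)

/-- The dimension of a module: `dim_R(M) = dim (R / ann_R M)`. -/
def moduleDim (M : Type u) [AddCommGroup M] [Module R M] : WithBot ℕ∞ :=
  ringKrullDim (R ⧸ Module.annihilator R M)

/-- A Cohen-Macaulay module over a local ring: `depth_R(M) = dim_R(M)`. -/
def IsCMModule [IsLocalRing R] (M : Type u) [AddCommGroup M] [Module R M] : Prop :=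
  (ldepth R M : WithBot ℕ∞) = moduleDim R M

/-- A maximal Cohen-Macaulay module over a local ring: `depth_R(M) = dim R`. -/
def IsMaximalCM [IsLocalRing R] (M : Type u) [AddCommGroup M] [Module R M] : Prop :=
  (ldepth R M : WithBot ℕ∞) = ringKrullDim R

/-- A Cohen-Macaulay local ring. -/
def IsCMLocalRing : Prop :=
  ∃ _ : IsLocalRing R, (ldepth R R : WithBot ℕ∞) = ringKrullDim R

/-- `C` has finite injective dimension: for some `n`, `Ext^i_R(-,C)` vanishes
for all `i > n`. -/
def HasFiniteInjDim (C : Type u) [AddCommGroup C] [Module R C] : Prop :=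
  ∃ n : ℕ, ∀ (M : ModuleCat.{u} R) (i : ℕ), n < i →
    Subsingleton (((Ext R (ModuleCat.{u} R) i).obj (Opposite.op M)).obj (ModuleCat.of R C))

/-- `ω` is a canonical module of `R`: a semidualizing module of finite injective
dimension. -/
def IsCanonicalModule (ω : Type u) [AddCommGroup ω] [Module R ω] : Prop :=
  IsSemidualizing R ω ∧ HasFiniteInjDim R ω

/-- `Gid_R(M) ≤ n`: there is an exact complex `⋯ → I_1 → I_0 → I_{-1} → ⋯` of
injective modules, which stays exact under `Hom_R(E,-)` for every injective `E`,
with `M ≅ ker(I_0 → I_{-1})` and `I_j = 0` for `j < -n`. -/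
def GidLE (M : Type u) [AddCommGroup M] [Module R M] (n : ℕ) : Prop :=
  ∃ (I : ℤ → ModuleCat.{u} R) (d : ∀ i : ℤ, (I (i+1) : Type u) →ₗ[R] I i),
    (∀ i : ℤ, Module.Injective R (I i)) ∧
    (∀ i : ℤ, LinearMap.range (d (i+1)) = LinearMap.ker (d i)) ∧
    (∀ E : ModuleCat.{u} R, Module.Injective R E →
      ∀ (i : ℤ) (φ : (E : Type u) →ₗ[R] I (i+1)), d i ∘ₗ φ = 0 →
        ∃ ψ : (E : Type u) →ₗ[R] I (i+1+1), d (i+1) ∘ₗ ψ = φ) ∧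
    Nonempty (M ≃ₗ[R] ↥(LinearMap.ker (d (-1)))) ∧
    (∀ i : ℤ, i < -(n : ℤ) → Subsingleton (I i))

/-- `M` has finite Gorenstein injective dimension. -/
def HasFiniteGid (M : Type u) [AddCommGroup M] [Module R M] : Prop :=
  ∃ n : ℕ, GidLE R M n

/-- The evaluation map `C ⊗_R Hom_R(C,M) → M`. -/
def evalMap (C M : Type u) [AddCommGroup C] [Module R C]
    [AddCommGroup M] [Module R M] : TensorProduct R C (C →ₗ[R] M) →ₗ[R] M :=
  TensorProduct.lift ((LinearMap.id : (C →ₗ[R] M) →ₗ[R] (C →ₗ[R] M)).flip)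

/-- Membership in the Bass class `B_C`. -/
def MemBass (C M : Type u) [AddCommGroup C] [Module R C]
    [AddCommGroup M] [Module R M] : Prop :=
  Function.Bijective (evalMap R C M) ∧
  (∀ i : ℕ, 0 < i → Subsingleton (TorGrp R (C →ₗ[R] M) C i)) ∧
  (∀ i : ℕ, 0 < i → Subsingleton (ExtGrp R C M i))

/-- Membership in the Auslander class `A_C`. -/
def MemAus (C M : Type u) [AddCommGroup C] [Module R C]
    [AddCommGroup M] [Module R M] : Prop :=
  Function.Bijective (TensorProduct.mk R M C) ∧
  (∀ i : ℕ, 0 < i → Subsingleton (TorGrp R M C i)) ∧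
  (∀ i : ℕ, 0 < i → Subsingleton (ExtGrp R C (TensorProduct R M C) i))

/-- The grade of a module: the common length of maximal `R`-regular sequences in
`ann_R(M)`, i.e. `inf{ i | Ext^i(R/ann M, R) ≠ 0 }`. -/
def gradeMod (M : Type u) [AddCommGroup M] [Module R M] : ℕ∞ :=
  edepth R (Module.annihilator R M) R

/-- The grade of an ideal `I`, i.e. `grade_R(R/I)`. -/
def gradeIdeal (I : Ideal R) : ℕ∞ :=
  edepth R I R

/-- An unmixed ideal: every associated prime of `R/I` is a minimal prime of `I`. -/
def IsUnmixedIdeal (I : Ideal R) : Prop :=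
  ∀ p ∈ associatedPrimes R (R ⧸ I), p ∈ I.minimalPrimes

/-- Equality of the `a`-th Bass number of `R` (over `R`, w.r.t. the maximal ideal `m`)
and the `b`-th Bass number of `A` (over `A`, w.r.t. the maximal ideal `mA`): both Ext
modules are vector spaces over the corresponding residue fields of one and the same
dimension. -/
def BassNumbersEq (m : Ideal R) (a : ℕ) (A : Type u) [CommRing A] (mA : Ideal A) (b : ℕ) : Prop :=
  ∃ ι : Type u,
    Nonempty (ExtGrp R (R ⧸ m) R a ≃ₗ[R] (ι →₀ (R ⧸ m))) ∧
    Nonempty (ExtGrp A (A ⧸ mA) A b ≃ₗ[A] (ι →₀ (A ⧸ mA)))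

/-- A quasi-Gorenstein ideal of a local ring `R`: `G-dim_R(R/a) < ∞` and
`μ^{i+depth R}_R(R) = μ^{i+depth R/a}_{R/a}(R/a)` for all `i ≥ 0`. -/
def IsQuasiGorensteinIdeal [IsLocalRing R] (a : Ideal R) : Prop :=
  GCdimFinite R R (R ⧸ a) ∧
  ∀ i : ℕ,
    BassNumbersEq R (IsLocalRing.maximalIdeal R) (i + (ldepth R R).toNat)
      (R ⧸ a) (Ideal.map (Ideal.Quotient.mk a) (IsLocalRing.maximalIdeal R))
      (i + (edepth (R ⧸ a) (Ideal.map (Ideal.Quotient.mk a) (IsLocalRing.maximalIdeal R))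
        (R ⧸ a)).toNat)

/-- `E` is an injective hull of `K`: `E` is injective and contains a copy of `K`
as an essential submodule. -/
def IsInjectiveHull (K E : Type u) [AddCommGroup K] [Module R K]
    [AddCommGroup E] [Module R E] : Prop :=
  Module.Injective R E ∧
  ∃ ι : K →ₗ[R] E, Function.Injective ι ∧
    ∀ N : Submodule R E, N ≠ ⊥ → N ⊓ LinearMap.range ι ≠ ⊥

/-- A generalized Cohen-Macaulay module over a local ring: `dim M ≥ 1` and
`H^i_m(M)` has finite length for all `i < dim M`. -/
def IsGeneralizedCM [IsLocalRing R] (M : Type u) [AddCommGroup M] [Module R M] : Prop :=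
  1 ≤ moduleDim R M ∧
  ∀ i : ℕ, (i : WithBot ℕ∞) < moduleDim R M →
    IsFiniteLength R (LocCoh R (IsLocalRing.maximalIdeal R) i M)

end Paper

open CategoryTheory Abelian in
theorem Paper.subsingleton_extGrp_succ_iff (R : Type u) [CommRing R] (M N : Type u)
    [AddCommGroup M] [Module R M] [AddCommGroup N] [Module R N] (k : ℕ) :
    Subsingleton (Paper.ExtGrp R M N (k + 1)) ↔
      Subsingleton (Abelian.Ext (ModuleCat.of R M) (ModuleCat.of R N) (k + 1)) := by
  let P := ProjectiveResolution.of (ModuleCat.of R M)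
  have h1 : Subsingleton (Paper.ExtGrp R M N (k + 1)) ↔
      ∀ f : P.complex.X (k + 1) ⟶ ModuleCat.of R N, P.complex.d (k + 2) (k + 1) ≫ f = 0 →
        ∃ g : P.complex.X k ⟶ ModuleCat.of R N, P.complex.d (k + 1) k ≫ g = f := by
    rw [← ModuleCat.isZero_iff_subsingleton,
      (P.isoExt (R := R) (k + 1) (ModuleCat.of R N)).isZero_iff,
      ← HomologicalComplex.exactAt_iff_isZero_homology,
      HomologicalComplex.exactAt_iff' _ k (k + 1) (k + 2) (by simp) (by simp),
      ShortComplex.moduleCat_exact_iff]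
    rfl
  rw [h1]
  constructor
  · intro h
    refine ⟨fun a b ↦ ?_⟩
    have key : ∀ a : Abelian.Ext (ModuleCat.of R M) (ModuleCat.of R N) (k + 1), a = 0 := by
      intro a
      obtain ⟨f, hf, rfl⟩ := P.extMk_surjective a (k + 2) rfl
      exact (P.extMk_eq_zero_iff f (k + 2) rfl hf k rfl).2 (h f hf)
    rw [key a, key b]
  · intro h f hf
    exact (P.extMk_eq_zero_iff f (k + 2) rfl hf k rfl).1 (Subsingleton.elim _ _)

namespace Paper

open CategoryTheory Abelian

section ExtSequences

variable {R : Type u} [CommRing R]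
  {A B D X : Type u} [AddCommGroup A] [Module R A] [AddCommGroup B] [Module R B]
  [AddCommGroup D] [Module R D] [AddCommGroup X] [Module R X]
  {i : A →ₗ[R] B} {p : B →ₗ[R] D}

variable (R) in
/-- `Ext^n_R(M,N) = 0`, for the `Ext` of the derived category. -/
abbrev ExtVanishes (M N : Type u) [AddCommGroup M] [Module R M] [AddCommGroup N] [Module R N]
    (n : ℕ) : Prop :=
  Subsingleton (Abelian.Ext (ModuleCat.of R M) (ModuleCat.of R N) n)

theorem shortExact_of_linearMap (hi : Function.Injective i) (hex : Function.Exact i p)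
    (hp : Function.Surjective p) :
    (ShortComplex.mk (ModuleCat.ofHom i) (ModuleCat.ofHom p)
      (by ext x; exact hex.apply_apply_eq_zero x)).ShortExact where
  exact := by
    rw [ShortComplex.moduleCat_exact_iff]
    exact fun x hx ↦ (hex x).1 hx
  mono_f := (ModuleCat.mono_iff_injective _).2 hi
  epi_g := (ModuleCat.epi_iff_surjective _).2 hp

theorem subsingleton_of_forall_eq_zero {G : Type*} [AddGroup G] (h : ∀ x : G, x = 0) :
    Subsingleton G :=
  ⟨fun a b ↦ by rw [h a, h b]⟩

theorem extVanishes_one_iff_of_shortExact (hi : Function.Injective i)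
    (hex : Function.Exact i p) (hp : Function.Surjective p) (hB : ExtVanishes R B X 1) :
    ExtVanishes R D X 1 ↔ ∀ φ : A →ₗ[R] X, ∃ ψ : B →ₗ[R] X, ψ ∘ₗ i = φ := by
  have hS := shortExact_of_linearMap hi hex hp
  constructor
  · intro h φ
    obtain ⟨x, hx⟩ := Ext.contravariant_sequence_exact₁ hS (ModuleCat.of R X)
      (Ext.mk₀ (ModuleCat.ofHom φ)) (n₁ := 1) rfl (Subsingleton.elim (h := h) _ _)
    obtain ⟨f, rfl⟩ := (Ext.mk₀_bijective _ _).2 x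
    rw [Ext.mk₀_comp_mk₀] at hx
    have := (Ext.mk₀_bijective _ _).1 hx
    exact ⟨f.hom, by simpa using congrArg ModuleCat.Hom.hom this⟩
  · intro h
    refine subsingleton_of_forall_eq_zero fun x ↦ ?_
    obtain ⟨y, rfl⟩ := Ext.contravariant_sequence_exact₃ hS (ModuleCat.of R X) x
      (Subsingleton.elim (h := hB) _ _) (n₀ := 0) rfl
    obtain ⟨f, rfl⟩ := (Ext.mk₀_bijective _ _).2 y
    obtain ⟨g, hg⟩ := h f.hom
    have : f = ModuleCat.ofHom i ≫ ModuleCat.ofHom g := by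
      ext1; simpa using hg.symm
    rw [this, ← Ext.mk₀_comp_mk₀]
    exact hS.extClass_comp_assoc _

theorem extVanishes_succ_iff_of_shortExact (hi : Function.Injective i)
    (hex : Function.Exact i p) (hp : Function.Surjective p) {n : ℕ}
    (hB : ExtVanishes R B X (n + 1)) (hB' : ExtVanishes R B X (n + 2)) :
    ExtVanishes R D X (n + 2) ↔ ExtVanishes R A X (n + 1) := by
  have hS := shortExact_of_linearMap hi hex hp
  constructor
  · intro h
    refine subsingleton_of_forall_eq_zero fun x ↦ ?_
    obtain ⟨y, rfl⟩ := Ext.contravariant_sequence_exact₁ hS (ModuleCat.of R X) x (n₁ := n + 2)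
      (by omega) (Subsingleton.elim (h := h) _ _)
    rw [Subsingleton.elim (h := hB) y 0, Ext.comp_zero]
  · intro h
    refine subsingleton_of_forall_eq_zero fun x ↦ ?_
    obtain ⟨y, rfl⟩ := Ext.contravariant_sequence_exact₃ hS (ModuleCat.of R X) x
      (Subsingleton.elim (h := hB') _ _) (n₀ := n + 1) (by omega)
    rw [Subsingleton.elim (h := h) y 0, Ext.comp_zero]

theorem ExtVanishes.of_shortExact_left (hi : Function.Injective i)
    (hex : Function.Exact i p) (hp : Function.Surjective p) {n : ℕ}
    (hA : ExtVanishes R A X n) (hD : ExtVanishes R D X n) : ExtVanishes R B X n := by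
  have hS := shortExact_of_linearMap hi hex hp
  refine subsingleton_of_forall_eq_zero fun x ↦ ?_
  obtain ⟨y, rfl⟩ := Ext.contravariant_sequence_exact₂ hS (ModuleCat.of R X) x
    (Subsingleton.elim (h := hA) _ _)
  rw [Subsingleton.elim (h := hD) y 0, Ext.comp_zero]

theorem ExtVanishes.of_shortExact_right (hi : Function.Injective i)
    (hex : Function.Exact i p) (hp : Function.Surjective p) {n : ℕ}
    (hA : ExtVanishes R X A n) (hD : ExtVanishes R X D n) : ExtVanishes R X B n := by
  have hS := shortExact_of_linearMap hi hex hp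
  refine subsingleton_of_forall_eq_zero fun x ↦ ?_
  obtain ⟨y, rfl⟩ := Ext.covariant_sequence_exact₂ (ModuleCat.of R X) hS x
    (Subsingleton.elim (h := hD) _ _)
  rw [Subsingleton.elim (h := hA) y 0, Ext.zero_comp]

theorem ExtVanishes.quotient_of_shortExact (hi : Function.Injective i)
    (hex : Function.Exact i p) (hp : Function.Surjective p) {n : ℕ}
    (hA : ExtVanishes R X A (n + 1)) (hB : ExtVanishes R X B n) : ExtVanishes R X D n := by
  have hS := shortExact_of_linearMap hi hex hp
  refine subsingleton_of_forall_eq_zero fun x ↦ ?_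
  obtain ⟨y, rfl⟩ := Ext.covariant_sequence_exact₃ (ModuleCat.of R X) hS x (n₁ := n + 1) rfl
    (Subsingleton.elim (h := hA) _ _)
  rw [Subsingleton.elim (h := hB) y 0, Ext.zero_comp]

theorem ExtVanishes.exists_lift_of_shortExact (hi : Function.Injective i)
    (hex : Function.Exact i p) (hp : Function.Surjective p)
    (hA : ExtVanishes R X A 1) (φ : X →ₗ[R] D) : ∃ ψ : X →ₗ[R] B, p ∘ₗ ψ = φ := by
  have hS := shortExact_of_linearMap hi hex hp
  obtain ⟨x, hx⟩ := Ext.covariant_sequence_exact₃ (ModuleCat.of R X) hS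
    (Ext.mk₀ (ModuleCat.ofHom φ)) (n₁ := 1) rfl (Subsingleton.elim (h := hA) _ _)
  obtain ⟨f, rfl⟩ := (Ext.mk₀_bijective _ _).2 x
  rw [Ext.mk₀_comp_mk₀] at hx
  have := (Ext.mk₀_bijective _ _).1 hx
  exact ⟨f.hom, by simpa using congrArg ModuleCat.Hom.hom this⟩

theorem ExtVanishes.congr_left (e : A ≃ₗ[R] B) {n : ℕ} (h : ExtVanishes R A X n) :
    ExtVanishes R B X n := by
  refine subsingleton_of_forall_eq_zero fun x ↦ ?_
  have : x = (Ext.mk₀ e.toModuleIso.inv).comp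
      ((Ext.mk₀ e.toModuleIso.hom).comp x (zero_add n)) (zero_add n) := by
    rw [Ext.mk₀_comp_mk₀_assoc, Iso.inv_hom_id, Ext.mk₀_id_comp]
  rw [this, Subsingleton.elim (h := h) ((Ext.mk₀ e.toModuleIso.hom).comp x (zero_add n)) 0,
    Ext.comp_zero]

theorem ExtVanishes.congr_right (e : A ≃ₗ[R] B) {n : ℕ} (h : ExtVanishes R X A n) :
    ExtVanishes R X B n := by
  refine subsingleton_of_forall_eq_zero fun x ↦ ?_
  have : x = (x.comp (Ext.mk₀ e.toModuleIso.inv) (add_zero n)).comp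
      (Ext.mk₀ e.toModuleIso.hom) (add_zero n) := by
    rw [Ext.comp_assoc_of_third_deg_zero, Ext.mk₀_comp_mk₀, Iso.inv_hom_id, Ext.comp_mk₀_id]
  rw [this, Subsingleton.elim (h := h) (x.comp (Ext.mk₀ e.toModuleIso.inv) (add_zero n)) 0,
    Ext.zero_comp]

theorem extVanishes_of_projective [Module.Projective R A] (n : ℕ) :
    ExtVanishes R A X (n + 1) :=
  have : Projective (ModuleCat.of R A) := inferInstance
  subsingleton_of_forall_eq_zero fun x ↦ x.eq_zero_of_projective

theorem extVanishes_of_subsingleton_right [Subsingleton A] (n : ℕ) : ExtVanishes R X A n := by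
  refine subsingleton_of_forall_eq_zero fun x ↦ ?_
  have h : 𝟙 (ModuleCat.of R A) = 0 := (ModuleCat.isZero_of_subsingleton _).eq_of_src _ _
  rw [← Ext.comp_mk₀_id x, h, Ext.mk₀_zero, Ext.comp_zero]

theorem ExtVanishes.fin_fun_right {n : ℕ} (h : ExtVanishes R X A n) :
    ∀ k : ℕ, ExtVanishes R X (Fin k → A) n
  | 0 => extVanishes_of_subsingleton_right n
  | k + 1 => (ExtVanishes.of_shortExact_right (R := R) (i := LinearMap.inl R A (Fin k → A))
      (p := LinearMap.snd R A (Fin k → A)) LinearMap.inl_injective .inl_snd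
      LinearMap.snd_surjective h (h.fin_fun_right k)).congr_right (Fin.consLinearEquiv R fun _ ↦ A)

theorem ExtVanishes.fin_fun_left {n : ℕ} (h : ExtVanishes R A X (n + 1)) :
    ∀ k : ℕ, ExtVanishes R (Fin k → A) X (n + 1)
  | 0 => extVanishes_of_projective n
  | k + 1 => (ExtVanishes.of_shortExact_left (R := R) (i := LinearMap.inl R A (Fin k → A))
      (p := LinearMap.snd R A (Fin k → A)) LinearMap.inl_injective .inl_snd
      LinearMap.snd_surjective h (h.fin_fun_left k)).congr_left (Fin.consLinearEquiv R fun _ ↦ A)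

theorem forall_subsingleton_extGrp_iff :
    (∀ i : ℕ, 0 < i → Subsingleton (ExtGrp R A B i)) ↔ ∀ n, ExtVanishes R A B (n + 1) := by
  constructor
  · exact fun h n ↦ (subsingleton_extGrp_succ_iff R A B n).1 (h _ n.succ_pos)
  · rintro h (_ | n) hn
    · omega
    · exact (subsingleton_extGrp_succ_iff R A B n).2 (h n)

end ExtSequences
end Paper

namespace Paper

section Tor

open scoped TensorProduct

variable (R : Type u) [CommRing R]

/-- A resolution of `C` by flat modules, cut into short exact sequences
`0 → K (n + 1) → F n → K n → 0` with `K 0 = C`. -/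
structure FlatResolution (C : Type u) [AddCommGroup C] [Module R C] where
  K : ℕ → ModuleCat.{u} R
  F : ℕ → ModuleCat.{u} R
  flat : ∀ n, Module.Flat R (F n)
  ι : ∀ n, K (n + 1) →ₗ[R] F n
  π : ∀ n, F n →ₗ[R] K n
  injective : ∀ n, Function.Injective (ι n)
  exact : ∀ n, Function.Exact (ι n) (π n)
  surjective : ∀ n, Function.Surjective (π n)
  equiv : K 0 ≃ₗ[R] C

variable {R} {C : Type u} [AddCommGroup C] [Module R C]

/-- `X ⊗ -` is exact on the resolution, i.e. `Tor_i(X, C) = 0` for `i > 0`. -/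
def FlatResolution.TorVanishes (F : FlatResolution R C) (X : Type u) [AddCommGroup X]
    [Module R X] : Prop :=
  ∀ n, Function.Injective ((F.ι n).lTensor X)

/-- The flat resolution underlying a projective resolution. -/
def FlatResolution.ofProjectiveResolution (P : ProjectiveResolution (ModuleCat.of R C)) :
    FlatResolution R C where
  K
    | 0 => ModuleCat.of R C
    | n + 1 => ModuleCat.of R (LinearMap.range (P.complex.d (n + 1) n).hom)
  F n := P.complex.X n
  flat n :=
    have : Module.Projective R (P.complex.X n) :=
      (IsProjective.iff_projective _).2 (P.projective n)
    inferInstance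
  ι n := (LinearMap.range (P.complex.d (n + 1) n).hom).subtype
  π
    | 0 => (P.π.f 0).hom
    | n + 1 => (P.complex.d (n + 1) n).hom.rangeRestrict
  injective n := Subtype.val_injective
  exact
    | 0 => fun x ↦ by
      refine ⟨fun hx ↦ ?_, ?_⟩
      · obtain ⟨y, hy⟩ := (ShortComplex.moduleCat_exact_iff _).1 P.exact₀ x hx
        exact ⟨⟨x, y, hy⟩, rfl⟩
      · rintro ⟨⟨_, y, rfl⟩, rfl⟩
        exact congrArg (fun f ↦ f.hom y) P.complex_d_comp_π_f_zero
    | n + 1 => fun x ↦ by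
      refine ⟨fun hx ↦ ?_, ?_⟩
      · obtain ⟨y, hy⟩ := (ShortComplex.moduleCat_exact_iff _).1 (P.exact_succ n) x
          (congrArg Subtype.val hx)
        exact ⟨⟨x, y, hy⟩, rfl⟩
      · rintro ⟨⟨_, y, rfl⟩, rfl⟩
        exact Subtype.ext (congrArg (fun f ↦ f.hom y) (P.complex.d_comp_d (n + 2) (n + 1) n))
  surjective
    | 0 => (ModuleCat.epi_iff_surjective _).1 inferInstance
    | n + 1 => LinearMap.surjective_rangeRestrict _
  equiv := LinearEquiv.refl R C

theorem exists_flatResolution_torVanishes (X : Type u) [AddCommGroup X] [Module R X]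
    (h : ∀ i : ℕ, 0 < i → Subsingleton (TorGrp R X C i)) :
    ∃ F : FlatResolution R C, F.TorVanishes X := by
  let P := ProjectiveResolution.of (ModuleCat.of R C)
  refine ⟨.ofProjectiveResolution P, fun n ↦ ?_⟩
  have h1 : Function.Exact ((P.complex.d (n + 2) (n + 1)).hom.lTensor X)
      ((P.complex.d (n + 1) n).hom.lTensor X) := by
    have := h (n + 1) n.succ_pos
    rw [← ModuleCat.isZero_iff_subsingleton] at this
    replace this := this.of_iso (P.isoLeftDerivedObj _ (n + 1)).symm
    have h2 : HomologicalComplex.ExactAt _ (n + 1) :=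
      (HomologicalComplex.exactAt_iff_isZero_homology _ _).2 this
    rw [HomologicalComplex.exactAt_iff' _ (n + 2) (n + 1) n (by simp) (by simp),
      ShortComplex.moduleCat_exact_iff] at h2
    intro x
    refine ⟨fun hx ↦ h2 x hx, ?_⟩
    rintro ⟨y, rfl⟩
    have h3 : (P.complex.d (n + 1) n).hom ∘ₗ (P.complex.d (n + 2) (n + 1)).hom = 0 := by
      rw [← ModuleCat.hom_comp, P.complex.d_comp_d, ModuleCat.hom_zero]
    rw [← LinearMap.comp_apply, ← LinearMap.lTensor_comp, h3, LinearMap.lTensor_zero,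
      LinearMap.zero_apply]
  have hd : ∀ n, (P.complex.d (n + 1) n).hom = (LinearMap.range (P.complex.d (n + 1) n).hom).subtype
      ∘ₗ (P.complex.d (n + 1) n).hom.rangeRestrict := fun n ↦ rfl
  rw [← LinearMap.ker_eq_bot, LinearMap.ker_eq_bot']
  intro z hz
  obtain ⟨z, rfl⟩ := LinearMap.lTensor_surjective X
    (LinearMap.surjective_rangeRestrict (P.complex.d (n + 1) n).hom) z
  obtain ⟨y, rfl⟩ := (h1 z).1 (by
    rw [hd, LinearMap.lTensor_comp]
    exact hz)
  have h3 : (P.complex.d (n + 1) n).hom.rangeRestrict ∘ₗ (P.complex.d (n + 2) (n + 1)).hom = 0 := by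
    ext x
    exact congrArg (fun f ↦ f.hom x) (P.complex.d_comp_d (n + 2) (n + 1) n)
  rw [← LinearMap.comp_apply, ← LinearMap.lTensor_comp, h3, LinearMap.lTensor_zero,
    LinearMap.zero_apply]
  rfl

variable {L P X : Type u} [AddCommGroup L] [Module R L] [AddCommGroup P] [Module R P]
  [AddCommGroup X] [Module R X]

theorem FlatResolution.TorVanishes.injective_rTensor {F : FlatResolution R C}
    (hX : F.TorVanishes X) {i : L →ₗ[R] P} {p : P →ₗ[R] X} (hi : Function.Injective i)
    (hex : Function.Exact i p) (hp : Function.Surjective p) (n : ℕ) :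
    Function.Injective (i.rTensor (F.K n)) := by
  rw [← LinearMap.ker_eq_bot, LinearMap.ker_eq_bot']
  intro z hz
  have comm : ∀ {A B D E : Type u} [AddCommGroup A] [Module R A] [AddCommGroup B] [Module R B]
      [AddCommGroup D] [Module R D] [AddCommGroup E] [Module R E] (f : A →ₗ[R] B)
      (g : D →ₗ[R] E) (x : A ⊗[R] D),
      g.lTensor B (f.rTensor D x) = f.rTensor E (g.lTensor A x) := fun f g x ↦ by
    rw [← LinearMap.comp_apply, ← LinearMap.comp_apply, LinearMap.lTensor_comp_rTensor,
      LinearMap.rTensor_comp_lTensor]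
  have := F.flat n
  obtain ⟨z', rfl⟩ := LinearMap.lTensor_surjective L (F.surjective n) z
  rw [← comm] at hz
  obtain ⟨w, hw⟩ := (lTensor_exact P (F.exact n) (F.surjective n) _).1 hz
  have hw' : p.rTensor (F.K (n + 1)) w = 0 := by
    apply hX n
    rw [map_zero, comm, hw, ← LinearMap.comp_apply, ← LinearMap.rTensor_comp,
      hex.linearMap_comp_eq_zero, LinearMap.rTensor_zero, LinearMap.zero_apply]
  obtain ⟨v, rfl⟩ := (rTensor_exact (F.K (n + 1)) hex hp _).1 hw'
  rw [comm] at hw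
  have hv := Module.Flat.rTensor_preserves_injective_linearMap i hi hw
  rw [← hv]
  exact (lTensor_exact L (F.exact n) (F.surjective n)).apply_apply_eq_zero v

theorem FlatResolution.TorVanishes.of_shortExact {F : FlatResolution R C}
    (hX : F.TorVanishes X) [Module.Flat R P] {i : L →ₗ[R] P} {p : P →ₗ[R] X}
    (hi : Function.Injective i) (hex : Function.Exact i p) (hp : Function.Surjective p) :
    F.TorVanishes L := by
  intro n
  have h1 := hX.injective_rTensor hi hex hp (n + 1)
  have h2 := Module.Flat.lTensor_preserves_injective_linearMap (M := P) _ (F.injective n)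
  have h3 : Function.Injective ((F.ι n).lTensor P ∘ₗ i.rTensor (F.K (n + 1))) := h2.comp h1
  rw [LinearMap.lTensor_comp_rTensor, ← LinearMap.rTensor_comp_lTensor] at h3
  exact Function.Injective.of_comp h3

end Tor

end Paper

namespace Paper

section GorensteinDimension

variable {R : Type u} [CommRing R]
  {W X Y : Type u} [AddCommGroup W] [Module R W] [AddCommGroup X] [Module R X]
  [AddCommGroup Y] [Module R Y]

theorem gcdimZero_iff : GCdimZero R W X ↔ Module.Finite R X ∧
    Function.Bijective (bidualityMap R W X) ∧ (∀ n, ExtVanishes R X W (n + 1)) ∧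
    ∀ n, ExtVanishes R (X →ₗ[R] W) W (n + 1) := by
  rw [← forall_subsingleton_extGrp_iff, ← forall_subsingleton_extGrp_iff, GCdimZero]

/-- A finitely generated module abstractly isomorphic to its bidual is reflexive. -/
theorem bidualityMap_bijective_of_equiv [Module.Finite R X]
    (e : X ≃ₗ[R] ((X →ₗ[R] W) →ₗ[R] W)) : Function.Bijective (bidualityMap R W X) := by
  let r : ((X →ₗ[R] W) →ₗ[R] W) →ₗ[R] X :=
    e.symm.toLinearMap ∘ₗ LinearMap.lcomp R W e.toLinearMap.flip
  have hr : ∀ x, r (bidualityMap R W X x) = x := fun x ↦ by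
    rw [LinearMap.comp_apply, LinearEquiv.coe_coe, LinearEquiv.symm_apply_eq]
    rfl
  have hinj : Function.Injective (r ∘ₗ e.toLinearMap) :=
    OrzechProperty.injective_of_surjective_endomorphism _ fun x ↦
      ⟨e.symm (bidualityMap R W X x), by simp [hr]⟩
  refine ⟨Function.LeftInverse.injective hr, fun Φ ↦ ⟨r Φ, ?_⟩⟩
  apply e.symm.injective
  apply hinj
  simp [hr]

theorem GCdimZero.congr (e : X ≃ₗ[R] Y) (h : GCdimZero R W X) : GCdimZero R W Y := by
  rw [gcdimZero_iff] at h ⊢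
  obtain ⟨h1, h2, h3, h4⟩ := h
  have := Module.Finite.equiv e
  refine ⟨this, bidualityMap_bijective_of_equiv ?_, fun n ↦ (h3 n).congr_left e,
    fun n ↦ (h4 n).congr_left (LinearEquiv.congrLeft W R e)⟩
  exact e.symm ≪≫ₗ LinearEquiv.ofBijective _ h2 ≪≫ₗ
    LinearEquiv.congrLeft W R (LinearEquiv.congrLeft W R e)

theorem GCdimZero.congr_iff (e : X ≃ₗ[R] Y) : GCdimZero R W X ↔ GCdimZero R W Y :=
  ⟨fun h ↦ h.congr e, fun h ↦ h.congr e.symm⟩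

theorem GCdimZero.dual [IsNoetherianRing R] [Module.Finite R W] (h : GCdimZero R W X) :
    GCdimZero R W (X →ₗ[R] W) := by
  rw [gcdimZero_iff] at h ⊢
  obtain ⟨h1, h2, h3, h4⟩ := h
  let e := LinearEquiv.ofBijective _ h2
  exact ⟨inferInstance, bidualityMap_bijective_of_equiv (LinearEquiv.congrLeft W R e), h4,
    fun n ↦ (h3 n).congr_left e⟩

section ShortExact

variable {K Q : Type u} [AddCommGroup K] [Module R K] [AddCommGroup Q] [Module R Q]
  {i : K →ₗ[R] Q} {p : Q →ₗ[R] Y}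

theorem exact_lcomp_of_surjective (hex : Function.Exact i p) (hp : Function.Surjective p) :
    Function.Exact (LinearMap.lcomp R W p) (LinearMap.lcomp R W i) := by
  intro φ
  constructor
  · intro h
    let e := hex.linearEquivOfSurjective hp
    have hφ : LinearMap.range i ≤ LinearMap.ker φ := by
      rintro _ ⟨k, rfl⟩
      exact LinearMap.congr_fun h k
    refine ⟨(LinearMap.range i).liftQ φ hφ ∘ₗ e.symm.toLinearMap, ?_⟩
    ext q
    have : e.symm (p q) = (LinearMap.range i).mkQ q := by
      rw [LinearEquiv.symm_apply_eq]
      rfl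
    simp [this]
  · rintro ⟨η, rfl⟩
    ext k
    simp [hex.apply_apply_eq_zero]

theorem lcomp_injective (hp : Function.Surjective p) :
    Function.Injective (LinearMap.lcomp R W p) :=
  fun _ _ h ↦ (LinearMap.cancel_right hp).1 h

variable [Module.Finite R Q] [Module.Projective R Q]

theorem bijective_bidualityMap_of_projective : Function.Bijective (bidualityMap R R Q) :=
  Module.bijective_dual_eval R Q

theorem GCdimZero.syzygy [IsNoetherianRing R] (hi : Function.Injective i)
    (hex : Function.Exact i p) (hp : Function.Surjective p) (h : GCdimZero R R Y) :
    GCdimZero R R K ∧ Function.Surjective (LinearMap.lcomp R R i) := by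
  rw [gcdimZero_iff] at h ⊢
  obtain ⟨h1, h2, h3, h4⟩ := h
  have hsurj : Function.Surjective (LinearMap.lcomp R R i) :=
    (extVanishes_one_iff_of_shortExact hi hex hp (extVanishes_of_projective 0)).1 (h3 0)
  have hQ := bijective_bidualityMap_of_projective (R := R) (Q := Q)
  refine ⟨⟨.of_injective i hi, ⟨?_, fun Φ ↦ ?_⟩, fun n ↦ ?_, ?_⟩, hsurj⟩
  · refine (injective_iff_map_eq_zero _).2 fun k hk ↦ ?_
    apply (injective_iff_map_eq_zero _).1 hi
    apply (injective_iff_map_eq_zero _).1 hQ.1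
    ext ψ
    exact LinearMap.congr_fun hk (ψ ∘ₗ i)
  · obtain ⟨q, hq⟩ := hQ.2 (Φ ∘ₗ LinearMap.lcomp R R i)
    obtain ⟨k, rfl⟩ := (hex q).1 <| (injective_iff_map_eq_zero _).1 h2.1 _ <| by
      ext η
      have := LinearMap.congr_fun hq (η ∘ₗ p)
      have h0 : LinearMap.lcomp R R i (η ∘ₗ p) = 0 := by
        ext k
        simp [hex.apply_apply_eq_zero]
      rw [LinearMap.comp_apply, h0, map_zero] at this
      exact this
    refine ⟨k, ?_⟩
    ext φ
    obtain ⟨ψ, rfl⟩ := hsurj φ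
    exact LinearMap.congr_fun hq ψ
  · exact (extVanishes_succ_iff_of_shortExact hi hex hp (extVanishes_of_projective _)
      (extVanishes_of_projective _)).1 (h3 (n + 1))
  · rintro (_ | n)
    · refine (extVanishes_one_iff_of_shortExact (lcomp_injective hp)
        (exact_lcomp_of_surjective hex hp) hsurj (extVanishes_of_projective 0)).2 fun Φ ↦ ?_
      obtain ⟨y, rfl⟩ := h2.2 Φ
      obtain ⟨q, rfl⟩ := hp y
      exact ⟨bidualityMap R R Q q, rfl⟩
    · exact (extVanishes_succ_iff_of_shortExact (lcomp_injective hp)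
        (exact_lcomp_of_surjective hex hp) hsurj (extVanishes_of_projective _)
        (extVanishes_of_projective _)).2 (h4 n)

theorem GCdimZero.of_syzygy [IsNoetherianRing R] (hi : Function.Injective i)
    (hex : Function.Exact i p) (hp : Function.Surjective p) (h : GCdimZero R R K)
    (hsurj : Function.Surjective (LinearMap.lcomp R R i)) : GCdimZero R R Y := by
  rw [gcdimZero_iff] at h ⊢
  obtain ⟨h1, h2, h3, h4⟩ := h
  have hQ := bijective_bidualityMap_of_projective (R := R) (Q := Q)
  have hex' := exact_lcomp_of_surjective (W := R) hex hp
  have hinj' := lcomp_injective (R := R) (W := R) hp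
  refine ⟨.of_surjective p hp, ⟨?_, fun Φ ↦ ?_⟩, ?_, fun n ↦ ?_⟩
  · refine (injective_iff_map_eq_zero _).2 fun y hy ↦ ?_
    obtain ⟨q, rfl⟩ := hp y
    obtain ⟨Φ, hΦ⟩ := (exact_lcomp_of_surjective (W := R) hex' hsurj (bidualityMap R R Q q)).1 <| by
      ext η
      exact LinearMap.congr_fun hy η
    obtain ⟨k, rfl⟩ := h2.2 Φ
    have : i k = q := hQ.1 (by
      ext ψ
      exact LinearMap.congr_fun hΦ ψ)
    rw [← this, hex.apply_apply_eq_zero]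
  · obtain ⟨Ψ, hΨ⟩ := (extVanishes_one_iff_of_shortExact hinj' hex' hsurj
      (extVanishes_of_projective 0)).1 (h4 0) Φ
    obtain ⟨q, rfl⟩ := hQ.2 Ψ
    exact ⟨p q, hΨ⟩
  · rintro (_ | n)
    · exact (extVanishes_one_iff_of_shortExact hi hex hp (extVanishes_of_projective 0)).2 hsurj
    · exact (extVanishes_succ_iff_of_shortExact hi hex hp (extVanishes_of_projective _)
        (extVanishes_of_projective _)).2 (h3 n)
  · exact (extVanishes_succ_iff_of_shortExact hinj' hex' hsurj (extVanishes_of_projective _)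
        (extVanishes_of_projective _)).1 (h4 (n + 1))

/-- For a torsionless module `Y` with presentation by a projective module `0 → K → Q → Y → 0`,
`Y` has G-dimension zero iff the image of `Q^* → K^*` does. -/
theorem gcdimZero_range_lcomp_iff [IsNoetherianRing R] (hi : Function.Injective i)
    (hex : Function.Exact i p) (hp : Function.Surjective p)
    (hY : Function.Injective (bidualityMap R R Y)) :
    GCdimZero R R (LinearMap.range (LinearMap.lcomp R R i)) ↔ GCdimZero R R Y := by
  constructor
  · intro h
    have hQ := bijective_bidualityMap_of_projective (R := R) (Q := Q)
    let A := LinearMap.range (LinearMap.lcomp R R i)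
    let ev : K →ₗ[R] (A →ₗ[R] R) := LinearMap.lcomp R R A.subtype ∘ₗ bidualityMap R R K
    have hev : Function.Bijective ev := by
      constructor
      · refine (injective_iff_map_eq_zero _).2 fun k hk ↦ ?_
        apply (injective_iff_map_eq_zero _).1 hi
        apply (injective_iff_map_eq_zero _).1 hQ.1
        ext ψ
        exact LinearMap.congr_fun hk ⟨ψ ∘ₗ i, ψ, rfl⟩
      · intro Φ
        obtain ⟨q, hq⟩ := hQ.2 (Φ ∘ₗ (LinearMap.lcomp R R i).rangeRestrict)
        obtain ⟨k, rfl⟩ := (hex q).1 <| (injective_iff_map_eq_zero _).1 hY _ <| by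
          ext η
          have := LinearMap.congr_fun hq (η ∘ₗ p)
          have h0 : (LinearMap.lcomp R R i).rangeRestrict (η ∘ₗ p) = 0 := by
            ext k
            simp [hex.apply_apply_eq_zero]
          rw [LinearMap.comp_apply, h0, map_zero] at this
          exact this
        refine ⟨k, ?_⟩
        ext ⟨_, ψ, rfl⟩
        exact LinearMap.congr_fun hq ψ
    let e := LinearEquiv.ofBijective ev hev
    refine (h.dual.congr e.symm).of_syzygy hi hex hp fun ψ ↦ ?_
    obtain ⟨⟨_, φ, rfl⟩, ha⟩ := h.2.1.2 (ψ ∘ₗ e.symm.toLinearMap)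
    refine ⟨φ, ?_⟩
    ext k
    have := LinearMap.congr_fun ha (e k)
    rwa [LinearMap.comp_apply, LinearEquiv.coe_coe, e.symm_apply_apply] at this
  · intro h
    obtain ⟨h1, h2⟩ := h.syzygy hi hex hp
    refine h1.dual.congr ?_
    rw [LinearMap.range_eq_top.2 h2]
    exact Submodule.topEquiv.symm

end ShortExact

end GorensteinDimension

end Paper

namespace Paper

section Semidualizing

open scoped TensorProduct

variable {R : Type u} [CommRing R] {C : Type u} [AddCommGroup C] [Module R C]

theorem IsSemidualizing.extVanishes (hC : IsSemidualizing R C) (n : ℕ) :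
    ExtVanishes R C C (n + 1) :=
  forall_subsingleton_extGrp_iff.1 hC.2.2 n

/-- The homothety isomorphism `R ≃ Hom(C, C)`. -/
def IsSemidualizing.homothety (hC : IsSemidualizing R C) : R ≃ₗ[R] (C →ₗ[R] C) :=
  LinearEquiv.ofBijective (LinearMap.lsmul R C) hC.2.1

/-- `Hom(Z ⊗ C, C) ≃ Hom(Z, R)` for a semidualizing module `C`. -/
def IsSemidualizing.homTensorEquiv (hC : IsSemidualizing R C) (Z : Type u) [AddCommGroup Z]
    [Module R Z] : (Z →ₗ[R] R) ≃ₗ[R] (Z ⊗[R] C →ₗ[R] C) :=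
  LinearEquiv.congrRight hC.homothety ≪≫ₗ TensorProduct.lift.equiv (.id R) Z C C

/-- `Hom(C, Hom(Z, C)) ≃ Hom(Z, R)` for a semidualizing module `C`. -/
def IsSemidualizing.homHomEquiv (hC : IsSemidualizing R C) (Z : Type u) [AddCommGroup Z]
    [Module R Z] : (Z →ₗ[R] R) ≃ₗ[R] (C →ₗ[R] Z →ₗ[R] C) :=
  LinearEquiv.congrRight hC.homothety ≪≫ₗ LinearMap.lflip

section

variable {Z : Type u} [AddCommGroup Z] [Module R Z]

/-- If there is no nonzero map from a semidualizing module to a finite module `T` over a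
Noetherian ring, then `T = 0`. -/
theorem IsSemidualizing.subsingleton_of_linearMap [IsNoetherianRing R] (hC : IsSemidualizing R C)
    {T : Type u} [AddCommGroup T] [Module R T] [Module.Finite R T]
    (h : ∀ f : C →ₗ[R] T, f = 0) : Subsingleton T := by
  have := hC.1
  obtain ⟨r, hr, hreg⟩ := IsSMulRegular.subsingleton_linearMap_iff.1
    (subsingleton_of_forall_eq_zero h)
  have hr0 : r = 0 := (injective_iff_map_eq_zero _).1 hC.2.1.1 r <| by
    ext c
    exact Module.mem_annihilator.1 hr c
  subst hr0
  exact subsingleton_of_forall_eq_zero fun t ↦ hreg (by simp)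

end

theorem exists_shortExact_fin_fun (R : Type u) [CommRing R] (Z : Type u) [AddCommGroup Z]
    [Module R Z] [Module.Finite R Z] :
    ∃ (k : ℕ) (L : Submodule R (Fin k → R)) (p : (Fin k → R) →ₗ[R] Z),
      Function.Exact L.subtype p ∧ Function.Surjective p := by
  obtain ⟨k, p, hp⟩ := Module.Finite.exists_fin' R Z
  exact ⟨k, LinearMap.ker p, p, LinearMap.exact_subtype_ker_map p, hp⟩

/-- `R^k ⊗ C ≃ C^k`. -/
def finFunTensorEquiv (R C : Type u) [CommRing R] [AddCommGroup C] [Module R C] (k : ℕ) :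
    (Fin k → R) ⊗[R] C ≃ₗ[R] (Fin k → C) :=
  TensorProduct.comm R _ _ ≪≫ₗ TensorProduct.piScalarRight R R C (Fin k)

theorem IsSemidualizing.extVanishes_tensor_iff [IsNoetherianRing R] (hC : IsSemidualizing R C)
    (F : FlatResolution R C) (n : ℕ) : ∀ (X : Type u) [AddCommGroup X] [Module R X]
    [Module.Finite R X], F.TorVanishes X →
      (ExtVanishes R (X ⊗[R] C) C (n + 1) ↔ ExtVanishes R X R (n + 1)) := by
  have key : ∀ (X : Type u) [AddCommGroup X] [Module R X] [Module.Finite R X],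
      F.TorVanishes X → ∃ (k : ℕ) (L : Submodule R (Fin k → R)) (p : (Fin k → R) →ₗ[R] X),
      Function.Exact L.subtype p ∧ Function.Surjective p ∧
      Function.Injective (L.subtype.rTensor C) ∧ F.TorVanishes L := by
    intro X _ _ _ hX
    obtain ⟨k, L, p, hex, hp⟩ := exists_shortExact_fin_fun R X
    refine ⟨k, L, p, hex, hp, ?_, hX.of_shortExact L.subtype_injective hex hp⟩
    have h := hX.injective_rTensor L.subtype_injective hex hp 0
    have hcomp : (L.subtype.rTensor C) ∘ₗ F.equiv.toLinearMap.lTensor L =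
        F.equiv.toLinearMap.lTensor _ ∘ₗ L.subtype.rTensor (F.K 0) := by
      rw [LinearMap.rTensor_comp_lTensor, LinearMap.lTensor_comp_rTensor]
    have hinj : Function.Injective (L.subtype.rTensor C ∘ₗ F.equiv.toLinearMap.lTensor L) := by
      rw [hcomp]
      exact (F.equiv.lTensor (Fin k → R)).injective.comp h
    exact (Function.Injective.of_comp_iff' _ (F.equiv.lTensor L).bijective).1 hinj
  have hfree (k n : ℕ) : ExtVanishes R ((Fin k → R) ⊗[R] C) C (n + 1) :=
    ((hC.extVanishes n).fin_fun_left k).congr_left (finFunTensorEquiv R C k).symm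
  induction n with
  | zero =>
    intro X _ _ _ hX
    obtain ⟨k, L, p, hex, hp, hinj, -⟩ := key X hX
    rw [extVanishes_one_iff_of_shortExact hinj (rTensor_exact C hex hp)
      (LinearMap.rTensor_surjective C hp) (hfree k 0),
      extVanishes_one_iff_of_shortExact L.subtype_injective hex hp (extVanishes_of_projective 0)]
    constructor
    · intro h φ
      obtain ⟨ψ, hψ⟩ := h (hC.homTensorEquiv L φ)
      obtain ⟨ψ, rfl⟩ := (hC.homTensorEquiv _).surjective ψ
      refine ⟨ψ, (hC.homTensorEquiv L).injective ?_⟩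
      rw [← hψ]
      ext
      rfl
    · intro h φ
      obtain ⟨φ, rfl⟩ := (hC.homTensorEquiv _).surjective φ
      obtain ⟨ψ, rfl⟩ := h φ
      refine ⟨hC.homTensorEquiv _ ψ, ?_⟩
      ext
      rfl
  | succ n ih =>
    intro X _ _ _ hX
    obtain ⟨k, L, p, hex, hp, hinj, hL⟩ := key X hX
    rw [extVanishes_succ_iff_of_shortExact hinj (rTensor_exact C hex hp)
      (LinearMap.rTensor_surjective C hp) (hfree k _) (hfree k _),
      extVanishes_succ_iff_of_shortExact L.subtype_injective hex hp
        (extVanishes_of_projective _) (extVanishes_of_projective _)]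
    exact ih L hL

theorem IsSemidualizing.extVanishes_of_dual [IsNoetherianRing R] (hC : IsSemidualizing R C)
    (n : ℕ) : ∀ (Z : Type u) [AddCommGroup Z] [Module R Z] [Module.Finite R Z],
    (∀ n, ExtVanishes R Z C (n + 1)) → (∀ n, ExtVanishes R C (Z →ₗ[R] C) (n + 1)) →
      ExtVanishes R Z R (n + 1) := by
  have hfree (k n : ℕ) : ExtVanishes R C ((Fin k → R) →ₗ[R] C) (n + 1) :=
    ((hC.extVanishes n).fin_fun_right k).congr_right (Module.piEquiv (Fin k) R C)
  induction n with
  | zero =>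
    intro Z _ _ _ h1 h2
    obtain ⟨k, L, p, hex, hp⟩ := exists_shortExact_fin_fun R Z
    have hsurj := (extVanishes_one_iff_of_shortExact L.subtype_injective hex hp
      (extVanishes_of_projective 0)).1 (h1 0)
    refine (extVanishes_one_iff_of_shortExact L.subtype_injective hex hp
      (extVanishes_of_projective 0)).2 fun φ ↦ ?_
    obtain ⟨ψ, hψ⟩ := (h2 0).exists_lift_of_shortExact (lcomp_injective hp)
      (exact_lcomp_of_surjective hex hp) hsurj (hC.homHomEquiv L φ)
    obtain ⟨ψ, rfl⟩ := (hC.homHomEquiv _).surjective ψ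
    refine ⟨ψ, (hC.homHomEquiv L).injective ?_⟩
    rw [← hψ]
    rfl
  | succ n ih =>
    intro Z _ _ _ h1 h2
    obtain ⟨k, L, p, hex, hp⟩ := exists_shortExact_fin_fun R Z
    have hsurj := (extVanishes_one_iff_of_shortExact L.subtype_injective hex hp
      (extVanishes_of_projective 0)).1 (h1 0)
    refine (extVanishes_succ_iff_of_shortExact L.subtype_injective hex hp
        (extVanishes_of_projective _) (extVanishes_of_projective _)).2 (ih L (fun n ↦ ?_)
          fun n ↦ ?_)
    · exact (extVanishes_succ_iff_of_shortExact L.subtype_injective hex hp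
        (extVanishes_of_projective _) (extVanishes_of_projective _)).1 (h1 (n + 1))
    · exact (h2 (n + 1)).quotient_of_shortExact (lcomp_injective hp)
        (exact_lcomp_of_surjective hex hp) hsurj (hfree k n)

/-- The module `Z` satisfies the conditions of the Auslander class not involving `Tor`. -/
def IsCoevalAcyclic (R C Z : Type u) [CommRing R] [AddCommGroup C] [Module R C] [AddCommGroup Z]
    [Module R Z] : Prop :=
  Function.Bijective (TensorProduct.mk R Z C) ∧ ∀ n, ExtVanishes R C (Z ⊗[R] C) (n + 1)

theorem IsCoevalAcyclic.congr {Z Z' : Type u} [AddCommGroup Z] [Module R Z] [AddCommGroup Z']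
    [Module R Z'] (h : IsCoevalAcyclic R C Z) (e : Z ≃ₗ[R] Z') : IsCoevalAcyclic R C Z' := by
  refine ⟨?_, fun n ↦ (h.2 n).congr_right (e.rTensor C)⟩
  have : (TensorProduct.mk R Z' C : Z' → _) =
      LinearEquiv.congrRight (M := C) (e.rTensor C) ∘ TensorProduct.mk R Z C ∘ e.symm := by
    funext z
    ext c
    change z ⊗ₜ c = e (e.symm z) ⊗ₜ c
    rw [e.apply_symm_apply]
  rw [this]
  exact (LinearEquiv.bijective _).comp (h.1.comp e.symm.bijective)

theorem IsSemidualizing.isCoevalAcyclic_fin_fun (hC : IsSemidualizing R C) (k : ℕ) :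
    IsCoevalAcyclic R C (Fin k → R) := by
  refine ⟨?_, fun n ↦
    ((hC.extVanishes n).fin_fun_right k).congr_right (finFunTensorEquiv R C k).symm⟩
  constructor
  · refine (injective_iff_map_eq_zero _).2 fun f hf ↦ ?_
    ext j
    refine (injective_iff_map_eq_zero _).1 hC.2.1.1 (f j) ?_
    ext c
    exact congrFun (congrArg (finFunTensorEquiv R C k) (LinearMap.congr_fun hf c)) j
  · intro g
    refine ⟨fun j ↦ hC.homothety.symm
      (LinearMap.proj j ∘ₗ (finFunTensorEquiv R C k).toLinearMap ∘ₗ g), ?_⟩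
    ext c
    apply (finFunTensorEquiv R C k).injective
    ext j
    exact LinearMap.congr_fun (hC.homothety.apply_symm_apply
      (LinearMap.proj j ∘ₗ (finFunTensorEquiv R C k).toLinearMap ∘ₗ g)) c

section ShortExact

variable {Z Q W : Type u} [AddCommGroup Z] [Module R Z] [AddCommGroup Q] [Module R Q]
  [AddCommGroup W] [Module R W] {i : Z →ₗ[R] Q} {p : Q →ₗ[R] W}

theorem IsCoevalAcyclic.injective_rTensor [IsNoetherianRing R] (hC : IsSemidualizing R C)
    [Module.Finite R Z] (hZ : IsCoevalAcyclic R C Z) (hQ : IsCoevalAcyclic R C Q)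
    (hi : Function.Injective i) : Function.Injective (i.rTensor C) := by
  have := hC.1
  rw [← LinearMap.ker_eq_bot, ← Submodule.subsingleton_iff_eq_bot]
  refine hC.subsingleton_of_linearMap fun f ↦ ?_
  obtain ⟨z, hz⟩ := hZ.1.2 ((LinearMap.ker (i.rTensor C)).subtype ∘ₗ f)
  have hz0 : z = 0 := by
    apply (injective_iff_map_eq_zero _).1 hi
    apply (injective_iff_map_eq_zero _).1 hQ.1.1
    ext c
    have : i.rTensor C (z ⊗ₜ c) = 0 := by
      rw [← TensorProduct.mk_apply, hz]
      exact (f c).2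
    exact this
  ext c
  simpa [hz0] using (LinearMap.congr_fun hz c).symm

theorem IsCoevalAcyclic.of_shortExact [IsNoetherianRing R] (hC : IsSemidualizing R C)
    [Module.Finite R Z] (hZ : IsCoevalAcyclic R C Z) (hQ : IsCoevalAcyclic R C Q)
    (hi : Function.Injective i) (hex : Function.Exact i p) (hp : Function.Surjective p) :
    IsCoevalAcyclic R C W := by
  have hi' := hZ.injective_rTensor hC hQ hi
  have hex' := rTensor_exact C hex hp
  have hp' := LinearMap.rTensor_surjective C hp
  refine ⟨⟨(injective_iff_map_eq_zero _).2 fun w hw ↦ ?_, fun f ↦ ?_⟩,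
    fun n ↦ (hZ.2 (n + 1)).quotient_of_shortExact hi' hex' hp' (hQ.2 n)⟩
  · obtain ⟨q, rfl⟩ := hp w
    have hq (c : C) : q ⊗ₜ[R] c ∈ LinearMap.range (i.rTensor C) :=
      (hex' _).1 (LinearMap.congr_fun hw c)
    let e := LinearEquiv.ofInjective _ hi'
    obtain ⟨z, hz⟩ := hZ.1.2 (e.symm.toLinearMap ∘ₗ
      (TensorProduct.mk R Q C q).codRestrict _ hq)
    have : i z = q := hQ.1.1 <| by
      ext c
      have h1 : e (z ⊗ₜ c) = ⟨q ⊗ₜ c, hq c⟩ := by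
        rw [← LinearEquiv.eq_symm_apply]
        exact LinearMap.congr_fun hz c
      exact congrArg Subtype.val h1
    rw [← this, hex.apply_apply_eq_zero]
  · obtain ⟨g, rfl⟩ := (hZ.2 0).exists_lift_of_shortExact hi' hex' hp' f
    obtain ⟨q, rfl⟩ := hQ.1.2 g
    exact ⟨p q, rfl⟩

end ShortExact

theorem dualTensorHom_comp_rTensor_lcomp {Y Z : Type u} [AddCommGroup Y] [Module R Y]
    [AddCommGroup Z] [Module R Z] (p : Y →ₗ[R] Z) (x : (Z →ₗ[R] R) ⊗[R] C) :
    dualTensorHom R Y C ((LinearMap.lcomp R R p).rTensor C x) = dualTensorHom R Z C x ∘ₗ p := by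
  induction x with
  | zero => simp
  | tmul => rfl
  | add x y hx hy => simp only [map_add, hx, hy, LinearMap.add_comp]

theorem IsSemidualizing.isCoevalAcyclic_dual_fin_fun (hC : IsSemidualizing R C) (k : ℕ) :
    IsCoevalAcyclic R C ((Fin k → R) →ₗ[R] R) :=
  (hC.isCoevalAcyclic_fin_fun k).congr (Module.piEquiv (Fin k) R R)

theorem IsSemidualizing.dualTensorHom_injective [IsNoetherianRing R] (hC : IsSemidualizing R C)
    (Z : Type u) [AddCommGroup Z] [Module R Z] [Module.Finite R Z]
    (hZ : IsCoevalAcyclic R C (Z →ₗ[R] R)) : Function.Injective (dualTensorHom R Z C) := by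
  obtain ⟨k, p, hp⟩ := Module.Finite.exists_fin' R Z
  have hinj := hZ.injective_rTensor hC (hC.isCoevalAcyclic_dual_fin_fun k)
    (lcomp_injective (W := R) hp)
  refine (injective_iff_map_eq_zero _).2 fun x hx ↦ ?_
  apply (injective_iff_map_eq_zero _).1 hinj
  apply (injective_iff_map_eq_zero _).1 (dualTensorHom_bijective (R := R)).injective
  rw [dualTensorHom_comp_rTensor_lcomp, hx, LinearMap.zero_comp]

/-- The class of modules of G-dimension zero whose dual is coevaluation acyclic is closed under
syzygies, and `Z^* ⊗ C → Hom(Z, C)` is bijective for `Z` in this class. -/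
theorem IsSemidualizing.dualTensorHom_bijective_and_exists_syzygy [IsNoetherianRing R] (hC : IsSemidualizing R C)
    (Z : Type u) [AddCommGroup Z] [Module R Z] (hG : GCdimZero R R Z)
    (hZ : IsCoevalAcyclic R C (Z →ₗ[R] R)) :
    Function.Bijective (dualTensorHom R Z C) ∧
    ∃ (k : ℕ) (L : Submodule R (Fin k → R)) (p : (Fin k → R) →ₗ[R] Z),
      Function.Exact L.subtype p ∧ Function.Surjective p ∧ GCdimZero R R L ∧
      IsCoevalAcyclic R C (L →ₗ[R] R) ∧
      Function.Surjective (LinearMap.lcomp R R L.subtype) := by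
  have := hG.1
  obtain ⟨k, L, p, hex, hp⟩ := exists_shortExact_fin_fun R Z
  obtain ⟨hL, hsurj⟩ := hG.syzygy L.subtype_injective hex hp
  have hex' := exact_lcomp_of_surjective (W := R) hex hp
  have hL' := hZ.of_shortExact hC (hC.isCoevalAcyclic_dual_fin_fun k) (lcomp_injective hp)
    hex' hsurj
  refine ⟨⟨hC.dualTensorHom_injective Z hZ, fun φ ↦ ?_⟩, k, L, p, hex, hp, hL, hL', hsurj⟩
  obtain ⟨x, hx⟩ := (dualTensorHom_bijective (R := R)).surjective (φ ∘ₗ p)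
  obtain ⟨y, rfl⟩ := (rTensor_exact C hex' hsurj x).1 <| by
    apply (injective_iff_map_eq_zero _).1 (hC.dualTensorHom_injective L hL')
    rw [dualTensorHom_comp_rTensor_lcomp, hx, LinearMap.comp_assoc, hex.linearMap_comp_eq_zero,
      LinearMap.comp_zero]
  rw [dualTensorHom_comp_rTensor_lcomp] at hx
  exact ⟨y, (LinearMap.cancel_right hp).1 hx⟩

theorem IsSemidualizing.extVanishes_of_gcdimZero [IsNoetherianRing R] (hC : IsSemidualizing R C)
    (n : ℕ) : ∀ (Z : Type u) [AddCommGroup Z] [Module R Z], GCdimZero R R Z →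
      IsCoevalAcyclic R C (Z →ₗ[R] R) → ExtVanishes R Z C (n + 1) := by
  induction n with
  | zero =>
    intro Z _ _ hG hZ
    obtain ⟨-, k, L, p, hex, hp, hL, hL', hsurj⟩ := hC.dualTensorHom_bijective_and_exists_syzygy Z hG hZ
    refine (extVanishes_one_iff_of_shortExact L.subtype_injective hex hp
      (extVanishes_of_projective 0)).2 fun φ ↦ ?_
    obtain ⟨x, rfl⟩ := (hC.dualTensorHom_bijective_and_exists_syzygy L hL hL').1.2 φ
    obtain ⟨y, rfl⟩ := LinearMap.rTensor_surjective C hsurj x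
    exact ⟨_, (dualTensorHom_comp_rTensor_lcomp _ _).symm⟩
  | succ n ih =>
    intro Z _ _ hG hZ
    obtain ⟨-, k, L, p, hex, hp, hL, hL', hsurj⟩ := hC.dualTensorHom_bijective_and_exists_syzygy Z hG hZ
    exact (extVanishes_succ_iff_of_shortExact L.subtype_injective hex hp
      (extVanishes_of_projective _) (extVanishes_of_projective _)).2 (ih L hL hL')

/-- For `M` in the Bass class, the evaluation isomorphism `Hom(C, M) ⊗ C ≃ M`. -/
def MemBass.equiv {M : Type u} [AddCommGroup M] [Module R M] (hB : MemBass R C M) :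
    (C →ₗ[R] M) ⊗[R] C ≃ₗ[R] M :=
  TensorProduct.comm R _ _ ≪≫ₗ LinearEquiv.ofBijective _ hB.1

theorem MemBass.isCoevalAcyclic {M : Type u} [AddCommGroup M] [Module R M]
    (hB : MemBass R C M) : IsCoevalAcyclic R C (C →ₗ[R] M) := by
  refine ⟨?_, fun n ↦ (forall_subsingleton_extGrp_iff.1 hB.2.2 n).congr_right hB.equiv.symm⟩
  have h : Function.LeftInverse (LinearEquiv.congrRight (M := C) hB.equiv)
      (TensorProduct.mk R (C →ₗ[R] M) C) := fun f ↦ by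
    ext
    rfl
  exact (Function.Bijective.of_comp_iff' (LinearEquiv.bijective _) _).1
    (by rw [h.comp_eq_id]; exact Function.bijective_id)

/-- For `M` in the Bass class, `Hom(M, C)` is the dual of `Hom(C, M)`. -/
def MemBass.dualEquiv {M : Type u} [AddCommGroup M] [Module R M] (hC : IsSemidualizing R C)
    (hB : MemBass R C M) : (M →ₗ[R] C) ≃ₗ[R] ((C →ₗ[R] M) →ₗ[R] R) :=
  LinearEquiv.congrLeft C R hB.equiv.symm ≪≫ₗ (hC.homTensorEquiv _).symm

/-- A module `M` in the Bass class has `G_C`-dimension zero iff `Hom(C, M)` has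
G-dimension zero. -/
theorem MemBass.gcdimZero_iff_hom [IsNoetherianRing R] (hC : IsSemidualizing R C)
    {M : Type u} [AddCommGroup M] [Module R M] [Module.Finite R M] (hB : MemBass R C M) :
    GCdimZero R C M ↔ GCdimZero R R (C →ₗ[R] M) := by
  have := hC.1
  obtain ⟨F, hF⟩ := exists_flatResolution_torVanishes (C →ₗ[R] M) hB.2.1
  constructor
  · intro h
    rw [gcdimZero_iff] at h ⊢
    obtain ⟨-, h2, h3, h4⟩ := h
    let e := LinearEquiv.ofBijective _ h2 ≪≫ₗ
      LinearEquiv.congrLeft C R (hB.dualEquiv hC)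
    refine ⟨inferInstance, bidualityMap_bijective_of_equiv
      (LinearEquiv.congrRight e ≪≫ₗ (hC.homHomEquiv _).symm), fun n ↦ ?_, fun n ↦ ?_⟩
    · exact (hC.extVanishes_tensor_iff F n _ hF).1 ((h3 n).congr_left hB.equiv.symm)
    · refine hC.extVanishes_of_dual n _ (fun n ↦ (h4 n).congr_left (hB.dualEquiv hC)) fun n ↦ ?_
      exact (forall_subsingleton_extGrp_iff.1 hB.2.2 n).congr_right e
  · intro h
    have hd := h.dual
    have hX := hB.isCoevalAcyclic
    let eX := LinearEquiv.ofBijective _ h.2.1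
    have hX' := hX.congr eX
    rw [gcdimZero_iff] at h ⊢
    refine ⟨inferInstance, bidualityMap_bijective_of_equiv ?_, fun n ↦ ?_, fun n ↦ ?_⟩
    · exact hB.equiv.symm ≪≫ₗ eX.rTensor C ≪≫ₗ
        LinearEquiv.ofBijective _ (hC.dualTensorHom_bijective_and_exists_syzygy _ hd hX').1 ≪≫ₗ
        LinearEquiv.congrLeft C R (hB.dualEquiv hC).symm
    · exact ((hC.extVanishes_tensor_iff F n _ hF).2 (h.2.2.1 n)).congr_left hB.equiv
    · exact (hC.extVanishes_of_gcdimZero n _ hd hX').congr_left (hB.dualEquiv hC).symm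

end Semidualizing

end Paper

namespace Paper

section Linkage

open scoped TensorProduct

variable {R : Type u} [CommRing R]

section ProjectiveCover

variable {P P' A : Type u} [AddCommGroup P] [Module R P] [AddCommGroup P'] [Module R P']
  [AddCommGroup A] [Module R A]

/-- Uniqueness of projective covers. -/
theorem exists_equiv_comp_eq_of_range_eq [Module.Projective R P] [Module.Projective R P']
    (g : P →ₗ[R] A) (g' : P' →ₗ[R] A) (h : LinearMap.range g = LinearMap.range g')
    (hg : ∀ N : Submodule R P, N ⊔ LinearMap.ker g = ⊤ → N = ⊤)
    (hg' : ∀ N : Submodule R P', N ⊔ LinearMap.ker g' = ⊤ → N = ⊤) :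
    ∃ e : P ≃ₗ[R] P', g' ∘ₗ e.toLinearMap = g := by
  obtain ⟨φ, hφ⟩ := Module.projective_lifting_property g'.rangeRestrict
    (g.codRestrict (LinearMap.range g') fun x ↦ h ▸ LinearMap.mem_range_self g x)
    g'.surjective_rangeRestrict
  have hφ' (x : P) : g' (φ x) = g x := congrArg Subtype.val (LinearMap.congr_fun hφ x)
  have hsurj : Function.Surjective φ := by
    refine LinearMap.range_eq_top.1 (hg' _ (eq_top_iff.2 fun y _ ↦ ?_))
    obtain ⟨x, hx⟩ : g' y ∈ LinearMap.range g := h ▸ LinearMap.mem_range_self g' y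
    refine Submodule.mem_sup.2 ⟨φ x, ⟨x, rfl⟩, y - φ x, ?_, by abel⟩
    rw [LinearMap.mem_ker, map_sub, hφ', hx, sub_self]
  obtain ⟨s, hs⟩ := Module.projective_lifting_property φ .id hsurj
  have hs' (y : P') : φ (s y) = y := LinearMap.congr_fun hs y
  have hsurj' : Function.Surjective s := by
    refine LinearMap.range_eq_top.1 (hg _ (eq_top_iff.2 fun x _ ↦ ?_))
    refine Submodule.mem_sup.2 ⟨s (φ x), ⟨φ x, rfl⟩, x - s (φ x), ?_, by abel⟩
    rw [LinearMap.mem_ker, map_sub, ← hφ' (s (φ x)), hs', hφ', sub_self]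
  refine ⟨LinearEquiv.ofBijective φ ⟨fun x y hxy ↦ ?_, hsurj⟩, LinearMap.ext hφ'⟩
  obtain ⟨x, rfl⟩ := hsurj' x
  obtain ⟨y, rfl⟩ := hsurj' y
  rw [hs', hs'] at hxy
  rw [hxy]

end ProjectiveCover

variable {C X N N' : Type u} [AddCommGroup C] [Module R C] [AddCommGroup X] [Module R X]
  [AddCommGroup N] [Module R N] [AddCommGroup N'] [Module R N']

theorem MinPres.nonempty_range_homC_equiv (p q : MinPres R X) :
    Nonempty (LinearMap.range (p.homC C) ≃ₗ[R] LinearMap.range (q.homC C)) := by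
  have := p.proj₀
  have := p.proj₁
  have := q.proj₀
  have := q.proj₁
  obtain ⟨e₀, he₀⟩ := exists_equiv_comp_eq_of_range_eq p.g q.g
    ((LinearMap.range_eq_top.2 p.surj).trans (LinearMap.range_eq_top.2 q.surj).symm) p.min₀ q.min₀
  have hker : LinearMap.ker (e₀.toLinearMap ∘ₗ p.f) = LinearMap.ker p.f :=
    LinearMap.ker_comp_of_ker_eq_bot _ e₀.ker
  obtain ⟨e₁, he₁⟩ := exists_equiv_comp_eq_of_range_eq (e₀.toLinearMap ∘ₗ p.f) q.f (by
    rw [LinearMap.range_comp, p.exact, q.exact, ← he₀, LinearMap.ker_comp,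
      Submodule.map_comap_eq_of_surjective e₀.surjective]) (by rw [hker]; exact p.min₁) q.min₁
  let E := LinearEquiv.congrLeft C R e₁
  have hE : (LinearMap.range (p.homC C)).map E.toLinearMap = LinearMap.range (q.homC C) := by
    apply le_antisymm
    · rintro _ ⟨_, ⟨φ, rfl⟩, rfl⟩
      refine ⟨φ ∘ₗ e₀.symm.toLinearMap, ?_⟩
      ext x
      obtain ⟨x, rfl⟩ := e₁.surjective x
      have h := LinearMap.congr_fun he₁ x
      change φ (e₀.symm (q.f (e₁ x))) = φ (p.f (e₁.symm (e₁ x)))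
      rw [e₁.symm_apply_apply, show q.f (e₁ x) = e₀ (p.f x) from h, e₀.symm_apply_apply]
    · rintro _ ⟨φ, rfl⟩
      refine ⟨_, ⟨φ ∘ₗ e₀.toLinearMap, rfl⟩, ?_⟩
      ext x
      obtain ⟨x, rfl⟩ := e₁.surjective x
      have h := LinearMap.congr_fun he₁ x
      change φ (e₀ (p.f (e₁.symm (e₁ x)))) = φ (q.f (e₁ x))
      rw [e₁.symm_apply_apply]
      exact congrArg φ h.symm
  exact ⟨E.submoduleMap _ ≪≫ₗ LinearEquiv.ofEq _ _ hE⟩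

theorem IsOmegaTrC.nonempty_equiv (h : IsOmegaTrC R C X N) (h' : IsOmegaTrC R C X N') :
    Nonempty (N ≃ₗ[R] N') := by
  obtain ⟨p, ⟨e⟩⟩ := h
  obtain ⟨q, ⟨e'⟩⟩ := h'
  obtain ⟨E⟩ := p.nonempty_range_homC_equiv (C := C) q
  exact ⟨e ≪≫ₗ E ≪≫ₗ e'.symm⟩

/-- `Hom(C, N)` is torsionless if `N` embeds into some `Hom(P, C)`. -/
theorem IsSemidualizing.bidualityMap_hom_injective (hC : IsSemidualizing R C) {P : Type u}
    [AddCommGroup P] [Module R P] (j : N →ₗ[R] (P →ₗ[R] C)) (hj : Function.Injective j) :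
    Function.Injective (bidualityMap R R (C →ₗ[R] N)) := by
  let κ : (C →ₗ[R] N) →ₗ[R] (P →ₗ[R] R) := (hC.homHomEquiv P).symm.toLinearMap ∘ₗ j.compRight R
  have hκ : Function.Injective κ :=
    (hC.homHomEquiv P).symm.injective.comp fun _ _ h ↦ (LinearMap.cancel_left hj).1 h
  refine (injective_iff_map_eq_zero _).2 fun y hy ↦ (injective_iff_map_eq_zero _).1 hκ y ?_
  ext x
  exact LinearMap.congr_fun hy (LinearMap.applyₗ x ∘ₗ κ)

/-- A semidualizing module `C` detects vanishing of finite modules via `- ⊗ C`. -/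
theorem IsSemidualizing.subsingleton_of_tensor [IsNoetherianRing R] (hC : IsSemidualizing R C)
    {E : Type u} [AddCommGroup E] [Module R E] [Module.Finite R E]
    [Subsingleton (E ⊗[R] C)] : Subsingleton E := by
  have : Subsingleton (E →ₗ[R] E) := hC.subsingleton_of_linearMap fun g ↦ by
    ext c x
    change TensorProduct.lift g.flip (x ⊗ₜ c) = 0
    rw [Subsingleton.elim (x ⊗ₜ[R] c) 0, map_zero]
  exact subsingleton_of_forall_eq_zero fun x ↦
    LinearMap.congr_fun (Subsingleton.elim (LinearMap.id : E →ₗ[R] E) 0) x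

/-- If `M` lies in the Bass class and is the image of `Hom(f, C)`, then `Hom(C, M)` is the image
of the dual of `f`. -/
theorem MemBass.nonempty_hom_equiv_range_lcomp [IsNoetherianRing R] (hC : IsSemidualizing R C)
    {M : Type u} [AddCommGroup M] [Module R M] [Module.Finite R M] (hB : MemBass R C M)
    {Q₁ Q₀ : Type u} [AddCommGroup Q₁] [Module R Q₁] [AddCommGroup Q₀] [Module R Q₀]
    [Module.Finite R Q₀] [Module.Projective R Q₀] (f : Q₁ →ₗ[R] Q₀)
    (θ : M ≃ₗ[R] LinearMap.range (LinearMap.lcomp R C f)) :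
    Nonempty ((C →ₗ[R] M) ≃ₗ[R] LinearMap.range (LinearMap.lcomp R R f)) := by
  have := hC.1
  let t : (Q₀ →ₗ[R] C) →ₗ[R] M := θ.symm.toLinearMap ∘ₗ (LinearMap.lcomp R C f).rangeRestrict
  have ht : Function.Surjective t :=
    θ.symm.surjective.comp (LinearMap.lcomp R C f).surjective_rangeRestrict
  let ρ : (Q₀ →ₗ[R] R) →ₗ[R] (C →ₗ[R] M) := t.compRight R ∘ₗ (hC.homHomEquiv Q₀).toLinearMap
  let s : M →ₗ[R] (Q₁ →ₗ[R] C) :=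
    (LinearMap.range (LinearMap.lcomp R C f)).subtype ∘ₗ θ.toLinearMap
  have hs : Function.Injective s := Subtype.val_injective.comp θ.injective
  let j : (C →ₗ[R] M) →ₗ[R] (Q₁ →ₗ[R] R) :=
    (hC.homHomEquiv Q₁).symm.toLinearMap ∘ₗ s.compRight R
  have hj : Function.Injective j :=
    (hC.homHomEquiv Q₁).symm.injective.comp fun _ _ h ↦ (LinearMap.cancel_left hs).1 h
  have hst (φ : Q₀ →ₗ[R] C) : s (t φ) = φ ∘ₗ f :=
    congrArg Subtype.val (θ.apply_symm_apply ((LinearMap.lcomp R C f).rangeRestrict φ))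
  have hjρ : j ∘ₗ ρ = LinearMap.lcomp R R f := by
    ext1 φ
    change (hC.homHomEquiv Q₁).symm _ = _
    rw [LinearEquiv.symm_apply_eq]
    ext1 c
    exact hst _
  have hρC : Function.Surjective (ρ.rTensor C) := by
    have h : hB.equiv.toLinearMap ∘ₗ ρ.rTensor C = t ∘ₗ dualTensorHom R Q₀ C := by
      refine TensorProduct.ext' fun φ c ↦ ?_
      change t _ = t _
      congr 1
    have h' : Function.Surjective (hB.equiv.toLinearMap ∘ₗ ρ.rTensor C) := by
      rw [h]
      exact ht.comp (dualTensorHom_bijective (R := R)).surjective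
    exact (Function.Surjective.of_comp_iff' hB.equiv.bijective _).1 h'
  have hρ : Function.Surjective ρ := by
    rw [← LinearMap.range_eq_top, ← Submodule.Quotient.subsingleton_iff]
    have : Subsingleton (((C →ₗ[R] M) ⧸ LinearMap.range ρ) ⊗[R] C) := by
      refine subsingleton_of_forall_eq_zero fun x ↦ ?_
      obtain ⟨x, rfl⟩ :=
        LinearMap.rTensor_surjective C (Submodule.mkQ_surjective (LinearMap.range ρ)) x
      obtain ⟨x, rfl⟩ := hρC x
      rw [← LinearMap.comp_apply, ← LinearMap.rTensor_comp, LinearMap.range_mkQ_comp,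
        LinearMap.rTensor_zero, LinearMap.zero_apply]
    exact hC.subsingleton_of_tensor
  refine ⟨LinearEquiv.ofInjective j hj ≪≫ₗ LinearEquiv.ofEq _ _ ?_⟩
  rw [← hjρ, LinearMap.range_comp_of_range_eq_top j (LinearMap.range_eq_top.2 hρ)]

/-- A presentation `Q₁ → Q₀ → Y → 0` of a torsionless module detects G-dimension zero on the image
of the dual map. -/
theorem gcdimZero_range_lcomp_iff_of_presentation [IsNoetherianRing R] {Q₁ Q₀ Y : Type u}
    [AddCommGroup Q₁] [Module R Q₁] [AddCommGroup Q₀] [Module R Q₀] [AddCommGroup Y] [Module R Y]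
    [Module.Finite R Q₀] [Module.Projective R Q₀] (f : Q₁ →ₗ[R] Q₀) (g : Q₀ →ₗ[R] Y)
    (hg : Function.Surjective g) (hfg : LinearMap.range f = LinearMap.ker g)
    (hY : Function.Injective (bidualityMap R R Y)) :
    GCdimZero R R (LinearMap.range (LinearMap.lcomp R R f)) ↔ GCdimZero R R Y := by
  rw [← gcdimZero_range_lcomp_iff (LinearMap.range f).subtype_injective
    (by rw [hfg]; exact LinearMap.exact_subtype_ker_map g) hg hY]
  have h : LinearMap.lcomp R R f = LinearMap.lcomp R R f.rangeRestrict ∘ₗ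
      LinearMap.lcomp R R (LinearMap.range f).subtype := rfl
  refine (GCdimZero.congr_iff (Submodule.equivMapOfInjective _
    (lcomp_injective f.surjective_rangeRestrict) _ ≪≫ₗ LinearEquiv.ofEq _ _ ?_)).symm
  rw [h, LinearMap.range_comp]

end Linkage

end Paper

open Paper in
/-- Theorem 4.2: if `M ∈ B_C` is horizontally linked with respect
to `C` then `G_C-dim_R(M) = 0` iff `G-dim_R(Hom_R(C, λ_R(C,M))) = 0`. -/
theorem stmt_10 (R : Type u) [CommRing R] [IsNoetherianRing R]
    (hsemiperf : IsSemiperfectRing R)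
    (C : Type u) [AddCommGroup C] [Module R C] (hC : IsSemidualizing R C)
    (M : Type u) [AddCommGroup M] [Module R M] [Module.Finite R M]
    (hB : MemBass R C M) (hlink : IsHorizontallyLinked R C M) :
    ∀ (N : Type u) [AddCommGroup N] [Module R N], IsLambdaOf R C M N →
      (GCdimZero R C M ↔ GCdimZero R R (C →ₗ[R] N)) := by
  intro N _ _ hN
  obtain ⟨N', h₁, pres, ⟨θ⟩⟩ := hlink
  obtain ⟨e⟩ := IsOmegaTrC.nonempty_equiv hN h₁
  obtain ⟨pres', ⟨θ'⟩⟩ := h₁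
  have := pres.finite₀
  have := pres.proj₀
  obtain ⟨E⟩ := hB.nonempty_hom_equiv_range_lcomp hC pres.f θ
  rw [hB.gcdimZero_iff_hom hC,
    GCdimZero.congr_iff (Y := LinearMap.range (LinearMap.lcomp R R pres.f)) E,
    GCdimZero.congr_iff (LinearEquiv.congrRight (M := C) e)]
  exact gcdimZero_range_lcomp_iff_of_presentation pres.f pres.g pres.surj pres.exact
    (hC.bidualityMap_hom_injective (Submodule.subtype _ ∘ₗ θ'.toLinearMap)
      (Subtype.val_injective.comp θ'.injective))
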